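/- arXiv:1603.01937 — 3 statements merged into one kernel-verified Lean document; each statement's English description precedes it below -/
import Mathlib

section
/- Let ℓ ∈ ℕ, let h ∈ ℝ with h ≠ 0, and let P(z) = Σ_{s=-m}^{n} c_s z^s be a Laurent polynomial with real coefficients. Assume that Σ_{s=-m}^{n} c_s g(x + s h) = 0 for every x ∈ ℝ and every real polynomial g of degree at most ℓ-1. Then (z-1)^ℓ divides P in the ring of Laurent polynomials ℝ[z,z⁻¹]; consequently there exists a Laurent polynomial P* with P(z) = (z-1)^ℓ P*(z), and T_h^{[P]}(f) = T_h^{[P*]}(Δ_h^ℓ f) for every function f : ℝ → ℝ. -/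
open MeasureTheory Finset
open scoped ENNReal
noncomputable section

/-! Common definitions for Dinh Dũng, "B-spline quasi-interpolation sampling representation
and sampling recovery in Sobolev spaces of mixed smoothness". -/

/-- Cardinal B-spline of order `ℓ`: `M_1 = 1_{[0,1)}`, `M_ℓ = M_{ℓ-1} * M_1` (convolution). -/
noncomputable def bspline : ℕ → ℝ → ℝ
  | 0, _ => 0
  | 1, x => if 0 ≤ x ∧ x < 1 then 1 else 0
  | (n+2), x => ∫ t in (0:ℝ)..1, bspline (n+1) (x - t)

/-- `h^{(k)} = ℓ⁻¹ 2^{-k}`. -/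
noncomputable def hstep (ℓ k : ℕ) : ℝ := ((ℓ : ℝ))⁻¹ * ((2:ℝ) ^ k)⁻¹

/-- The univariate quasi-interpolation coefficient
`a_{k,s}(f) = Σ_{|j|≤μ} λ(j) f(h^{(k)}(s - j + ℓ/2))`. -/
noncomputable def acoef (ℓ μ : ℕ) (lam : ℤ → ℝ) (k : ℕ) (s : ℤ) (f : ℝ → ℝ) : ℝ :=
  ∑ j ∈ Finset.Icc (-(μ:ℤ)) (μ:ℤ), lam j * f (hstep ℓ k * ((s : ℝ) - (j : ℝ) + (ℓ : ℝ)/2))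

/-- The base quasi-interpolation operator `Q(f,x) = Σ_s Λ(f,s) M(x-s)`. -/
noncomputable def Qbase (ℓ μ : ℕ) (lam : ℤ → ℝ) (f : ℝ → ℝ) (x : ℝ) : ℝ :=
  ∑' s : ℤ, (∑ j ∈ Finset.Icc (-(μ:ℤ)) (μ:ℤ), lam j * f ((s:ℝ) - (j:ℝ) + (ℓ:ℝ)/2)) *
    bspline ℓ (x - (s:ℝ))

/-- The scaled operator `Q_k(f,x) = Σ_s a_{k,s}(f) M(ℓ2^k x - s)`. -/
noncomputable def Qk (ℓ μ : ℕ) (lam : ℤ → ℝ) (k : ℕ) (f : ℝ → ℝ) (x : ℝ) : ℝ :=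
  ∑' s : ℤ, acoef ℓ μ lam k s f * bspline ℓ ((ℓ:ℝ) * 2^k * x - (s:ℝ))

/-- The sequence `Λ` is even: `λ(-j) = λ(j)`. -/
def IsEvenSeq (lam : ℤ → ℝ) : Prop := ∀ j : ℤ, lam (-j) = lam j

/-- `Q` is a quasi-interpolation operator: it reproduces all polynomials of degree `≤ ℓ-1`. -/
def IsQuasiInterp (ℓ μ : ℕ) (lam : ℤ → ℝ) : Prop :=
  ∀ g : Polynomial ℝ, g.degree < (ℓ : WithBot ℕ) →
    ∀ x : ℝ, Qbase ℓ μ lam (fun y => Polynomial.eval y g) x = Polynomial.eval x g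

/-- `N_k`: the 1-periodic extension of `M(ℓ2^k ·)`. -/
noncomputable def Nper (ℓ k : ℕ) (x : ℝ) : ℝ := ∑' n : ℤ, bspline ℓ ((ℓ:ℝ) * 2^k * (x - (n:ℝ)))

/-- `N_{k,s}(x) = N_k(x - h^{(k)} s)`. -/
noncomputable def Nks (ℓ k : ℕ) (s : ℤ) (x : ℝ) : ℝ := Nper ℓ k (x - hstep ℓ k * (s:ℝ))

/-- The coefficient of `z^s` in a Laurent polynomial. -/
noncomputable def lcoeff (P : LaurentPolynomial ℝ) (s : ℤ) : ℝ := (P.coeff : ℤ →₀ ℝ) s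

/-- The shift operator `T_h^{[P]}(f)(x) = Σ_s c_s f(x + s h)` generated by a Laurent
polynomial `P(z) = Σ_s c_s z^s`. -/
noncomputable def shiftOp (P : LaurentPolynomial ℝ) (h : ℝ) (f : ℝ → ℝ) (x : ℝ) : ℝ :=
  Finsupp.sum P.coeff fun s c => c * f (x + (s : ℝ) * h)

/-- The `ℓ`-th difference operator `Δ_h^ℓ f(x) = Σ_{j=0}^ℓ (-1)^{ℓ-j} C(ℓ,j) f(x+jh)`. -/
noncomputable def deltaOp (ℓ : ℕ) (h : ℝ) (f : ℝ → ℝ) (x : ℝ) : ℝ :=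
  ∑ j ∈ Finset.range (ℓ+1), (-1:ℝ)^(ℓ - j) * (ℓ.choose j : ℝ) * f (x + (j:ℝ) * h)

/-- The multivariate shift operator `T_𝐡^{[P]}` generated by the tensor-product Laurent
polynomial `P(𝐳) = ∏_j P_j(z_j)`. -/
noncomputable def tensorShift {d : ℕ} (P : Fin d → LaurentPolynomial ℝ) (h : Fin d → ℝ)
    (f : (Fin d → ℝ) → ℝ) (x : Fin d → ℝ) : ℝ :=
  ∑ s ∈ Fintype.piFinset (fun j => (((P j).coeff : ℤ →₀ ℝ)).support),
    (∏ j, lcoeff (P j) (s j)) * f (fun j => x j + (s j : ℝ) * h j)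

/-- `P_Λ(z) = z^{ℓ/2} Σ_{|s|≤μ} λ(s) z^s`. -/
noncomputable def PLam (ℓ μ : ℕ) (lam : ℤ → ℝ) : LaurentPolynomial ℝ :=
  ∑ s ∈ Finset.Icc (-(μ:ℤ)) (μ:ℤ),
    LaurentPolynomial.C (lam s) * LaurentPolynomial.T (s + (ℓ:ℤ)/2)

/-- `P_Λ(z²)`. -/
noncomputable def PLamSq (ℓ μ : ℕ) (lam : ℤ → ℝ) : LaurentPolynomial ℝ :=
  ∑ s ∈ Finset.Icc (-(μ:ℤ)) (μ:ℤ),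
    LaurentPolynomial.C (lam s) * LaurentPolynomial.T (2*(s + (ℓ:ℤ)/2))

/-- `P'_even(z) = 2^{-ℓ+1} P_Λ(z²) Σ_{j=0}^{ℓ/2} C(ℓ,2j) z^{-2j}`. -/
noncomputable def PevenAux (ℓ μ : ℕ) (lam : ℤ → ℝ) : LaurentPolynomial ℝ :=
  LaurentPolynomial.C ((2:ℝ) ^ (1 - (ℓ:ℤ))) * PLamSq ℓ μ lam *
    ∑ j ∈ Finset.range (ℓ/2 + 1),
      LaurentPolynomial.C ((ℓ.choose (2*j) : ℝ)) * LaurentPolynomial.T (-(2*(j:ℤ)))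

/-- `P'_odd(z) = 2^{-ℓ+1} P_Λ(z²) Σ_{j=0}^{ℓ/2-1} C(ℓ,2j+1) z^{-2j-1}`. -/
noncomputable def PoddAux (ℓ μ : ℕ) (lam : ℤ → ℝ) : LaurentPolynomial ℝ :=
  LaurentPolynomial.C ((2:ℝ) ^ (1 - (ℓ:ℤ))) * PLamSq ℓ μ lam *
    ∑ j ∈ Finset.range (ℓ/2),
      LaurentPolynomial.C ((ℓ.choose (2*j+1) : ℝ)) * LaurentPolynomial.T (-(2*(j:ℤ)) - 1)

/-- `P_even = P_Λ - P'_even`. -/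
noncomputable def Peven (ℓ μ : ℕ) (lam : ℤ → ℝ) : LaurentPolynomial ℝ :=
  PLam ℓ μ lam - PevenAux ℓ μ lam

/-- `P_odd = P_Λ - P'_odd`. -/
noncomputable def Podd (ℓ μ : ℕ) (lam : ℤ → ℝ) : LaurentPolynomial ℝ :=
  PLam ℓ μ lam - PoddAux ℓ μ lam

/-- A symmetric Laurent polynomial: its coefficients are symmetric about some
(possibly half-integer) center `c/2`. -/
def IsSymmLaurent (P : LaurentPolynomial ℝ) : Prop :=
  ∃ c : ℤ, ∀ s : ℤ, lcoeff P s = lcoeff P (c - s)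

/-- The unit cube `[0,1]^d`, a model of the torus `𝕋^d`. -/
def cube (d : ℕ) : Set (Fin d → ℝ) := Set.univ.pi fun _ => Set.Icc (0:ℝ) 1

/-- Lebesgue measure restricted to the unit cube. -/
noncomputable def μcube (d : ℕ) : Measure (Fin d → ℝ) := volume.restrict (cube d)

/-- `f` is 1-periodic in each variable, i.e. a function on the torus `𝕋^d`. -/
def PeriodicTd {d : ℕ} (f : (Fin d → ℝ) → ℝ) : Prop :=
  ∀ (x : Fin d → ℝ) (j : Fin d), f (Function.update x j (x j + 1)) = f x

/-- The univariate operator `Q_k` applied in the `j`-th variable. -/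
noncomputable def QkCoord (ℓ μ : ℕ) (lam : ℤ → ℝ) {d : ℕ} (j : Fin d) (k : ℕ)
    (f : (Fin d → ℝ) → ℝ) (x : Fin d → ℝ) : ℝ :=
  ∑' s : ℤ, (∑ i ∈ Finset.Icc (-(μ:ℤ)) (μ:ℤ), lam i *
      f (Function.update x j (hstep ℓ k * ((s:ℝ) - (i:ℝ) + (ℓ:ℝ)/2)))) *
    bspline ℓ ((ℓ:ℝ) * 2^k * x j - (s:ℝ))

/-- `Q_{k} - Q_{k-1}` in the `j`-th variable, with the convention `Q_{-1} = 0`. -/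
noncomputable def qdiffCoord (ℓ μ : ℕ) (lam : ℤ → ℝ) {d : ℕ} (j : Fin d) :
    ℕ → ((Fin d → ℝ) → ℝ) → (Fin d → ℝ) → ℝ
  | 0, f => QkCoord ℓ μ lam j 0 f
  | (k+1), f => fun x => QkCoord ℓ μ lam j (k+1) f x - QkCoord ℓ μ lam j k f x

/-- The mixed operator `Q_𝐤 = ∏_i Q_{k_i}`. -/
noncomputable def Qmix (ℓ μ : ℕ) (lam : ℤ → ℝ) {d : ℕ} (k : Fin d → ℕ)
    (f : (Fin d → ℝ) → ℝ) : (Fin d → ℝ) → ℝ :=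
  (List.finRange d).foldr (fun j g => QkCoord ℓ μ lam j (k j) g) f

/-- The mixed operator `q_𝐤 = ∏_i (Q_{k_i} - Q_{k_i-1})`. -/
noncomputable def qmix (ℓ μ : ℕ) (lam : ℤ → ℝ) {d : ℕ} (k : Fin d → ℕ)
    (f : (Fin d → ℝ) → ℝ) : (Fin d → ℝ) → ℝ :=
  (List.finRange d).foldr (fun j g => qdiffCoord ℓ μ lam j (k j) g) f

/-- The `𝐬`-th Fourier coefficient of a function on `𝕋^d`. -/
noncomputable def fourierCoeffCube (d : ℕ) (f : (Fin d → ℝ) → ℝ) (s : Fin d → ℤ) : ℂ :=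
  ∫ x in cube d, (f x : ℂ) *
    Complex.exp (-(2 * Real.pi * Complex.I) * (∑ j, (s j : ℂ) * (x j : ℂ)))

/-- `Σ_𝐬 f̂(𝐬) ∏_j (1+|s_j|²)^{r/2} e^{2πi(𝐬,x)}`. -/
noncomputable def WKernel (d : ℕ) (r : ℝ) (f : (Fin d → ℝ) → ℝ) (x : Fin d → ℝ) : ℂ :=
  ∑' s : Fin d → ℤ, fourierCoeffCube d f s * (((∏ j, ((1:ℝ) + (s j : ℝ)^2) ^ (r/2)) : ℝ) : ℂ) *
    Complex.exp ((2 * Real.pi * Complex.I) * (∑ j, (s j : ℂ) * (x j : ℂ)))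

/-- The norm of the Sobolev space `W^r_p` of mixed smoothness `r` on `𝕋^d`. -/
noncomputable def WNorm (d : ℕ) (r : ℝ) (p : ℝ≥0∞) (f : (Fin d → ℝ) → ℝ) : ℝ≥0∞ :=
  eLpNorm (WKernel d r f) p (μcube d)

/-- The Littlewood–Paley square function `(Σ_𝐤 |2^{r|𝐤|₁} q_𝐤(f)|²)^{1/2}`. -/
noncomputable def lpSqFn (d ℓ μ : ℕ) (lam : ℤ → ℝ) (r : ℝ) (f : (Fin d → ℝ) → ℝ)
    (x : Fin d → ℝ) : ℝ :=
  Real.sqrt (∑' k : Fin d → ℕ, ((2:ℝ) ^ (r * ∑ j, (k j : ℝ)) * qmix ℓ μ lam k f x) ^ 2)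

/-- The Smolyak-type sampling operator `R_m(f) = Σ_{|𝐤|₁ ≤ m} q_𝐤(f)`. -/
noncomputable def Rop (ℓ μ : ℕ) (lam : ℤ → ℝ) {d : ℕ} (m : ℕ) (f : (Fin d → ℝ) → ℝ)
    (x : Fin d → ℝ) : ℝ :=
  ∑ k ∈ (Fintype.piFinset fun _ : Fin d => Finset.range (m+1)).filter
      (fun k => ∑ j, k j ≤ m), qmix ℓ μ lam k f x

/-- The unit ball `U^r_p` of `W^r_p` (represented by continuous periodic functions). -/
def unitBallW (d : ℕ) (r p : ℝ) : Set ((Fin d → ℝ) → ℝ) :=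
  {f | Continuous f ∧ PeriodicTd f ∧ WNorm d r (ENNReal.ofReal p) f ≤ 1}

/-- The sampling width `r_n(F, L_q)`. -/
noncomputable def sampWidth (d n : ℕ) (q : ℝ≥0∞) (F : Set ((Fin d → ℝ) → ℝ)) : ℝ≥0∞ :=
  ⨅ (X : Fin n → (Fin d → ℝ)) (Φ : Fin n → (Fin d → ℝ) → ℝ),
    ⨆ f ∈ F, eLpNorm (fun x => f x - ∑ j, f (X j) * Φ j x) q (μcube d)

/-- The Smolyak grid `G^d(m) = {2^{-𝐤}𝐬 : 𝐤 ∈ ℕ^d, |𝐤|₁ = m, 0 ≤ s_j ≤ 2^{k_j}-1}`. -/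
noncomputable def smolyakGrid (d m : ℕ) : Finset (Fin d → ℝ) := by
  classical
  exact ((Fintype.piFinset fun _ : Fin d => Finset.Icc 1 m).filter fun k => ∑ j, k j = m).biUnion
    fun k => (Fintype.piFinset fun j => Finset.range (2 ^ (k j))).image
      fun s => fun j => (s j : ℝ) / 2 ^ (k j)

/-- The Smolyak sampling width `r_n^s(F, L_q)`. -/
noncomputable def smolyakWidth (d n : ℕ) (q : ℝ≥0∞) (F : Set ((Fin d → ℝ) → ℝ)) : ℝ≥0∞ :=
  ⨅ (m : ℕ) (_ : (smolyakGrid d m).card ≤ n) (Φ : (Fin d → ℝ) → (Fin d → ℝ) → ℝ),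
    ⨆ f ∈ F, eLpNorm (fun x => f x - ∑ y ∈ smolyakGrid d m, f y * Φ y x) q (μcube d)

/-- The `a`-th difference in the `j`-th coordinate. -/
noncomputable def deltaCoord {d : ℕ} (a : ℕ) (j : Fin d) (t : ℝ)
    (f : (Fin d → ℝ) → ℝ) (x : Fin d → ℝ) : ℝ :=
  ∑ i ∈ Finset.range (a+1), (-1:ℝ)^(a - i) * (a.choose i : ℝ) *
    f (Function.update x j (x j + (i:ℝ) * t))

/-- The mixed `(a,u)`-th difference `Δ_𝐡^{a,u} = ∏_{i∈u} Δ_{h_i}^a`. -/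
noncomputable def mixedDelta {d : ℕ} (a : ℕ) (u : Finset (Fin d)) (h : Fin d → ℝ)
    (f : (Fin d → ℝ) → ℝ) : (Fin d → ℝ) → ℝ :=
  u.toList.foldr (fun j g => deltaCoord a j (h j) g) f

/-- The mixed modulus of smoothness `ω_a^u(f,𝐭)_p`. -/
noncomputable def besovModulus (d a : ℕ) (u : Finset (Fin d)) (p : ℝ≥0∞)
    (t : Fin d → ℝ) (f : (Fin d → ℝ) → ℝ) : ℝ≥0∞ :=
  ⨆ h : {h : Fin d → ℝ // ∀ i ∈ u, |h i| < t i}, eLpNorm (mixedDelta a u h.1 f) p (μcube d)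

/-- The Besov quasi-seminorm `|f|_{B^{r,u}_{p,θ}}`. -/
noncomputable def besovSemi (d a : ℕ) (p θ : ℝ≥0∞) (r : ℝ) (u : Finset (Fin d))
    (f : (Fin d → ℝ) → ℝ) : ℝ≥0∞ :=
  if θ = ⊤ then
    ⨆ (t : Fin d → ℝ) (_ : t ∈ cube d),
      (∏ i ∈ u, ENNReal.ofReal ((t i) ^ (-r))) * besovModulus d a u p t f
  else
    (∫⁻ t in cube d,
      ((∏ i ∈ u, ENNReal.ofReal ((t i) ^ (-r))) * besovModulus d a u p t f) ^ θ.toReal *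
        (∏ i ∈ u, ENNReal.ofReal (t i)⁻¹)) ^ (1/θ.toReal)

/-- The Besov quasi-norm `‖f‖_{B^r_{p,θ}} = Σ_{u⊂[d]} |f|_{B^{r,u}_{p,θ}}`. -/
noncomputable def besovNorm (d a : ℕ) (p θ : ℝ≥0∞) (r : ℝ)
    (f : (Fin d → ℝ) → ℝ) : ℝ≥0∞ :=
  ∑ u : Finset (Fin d), besovSemi d a p θ r u f

/-- The sequence quasi-norm `(Σ_𝐤 2^{r|𝐤|₁θ} ‖g_𝐤‖_p^θ)^{1/θ}` (sup when `θ = ∞`). -/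
noncomputable def seqNormB (d : ℕ) (p θ : ℝ≥0∞) (r : ℝ)
    (g : (Fin d → ℕ) → (Fin d → ℝ) → ℝ) : ℝ≥0∞ :=
  if θ = ⊤ then
    ⨆ k : Fin d → ℕ, ENNReal.ofReal ((2:ℝ) ^ (r * ∑ j, (k j : ℝ))) * eLpNorm (g k) p (μcube d)
  else
    (∑' k : Fin d → ℕ,
      (ENNReal.ofReal ((2:ℝ) ^ (r * ∑ j, (k j : ℝ))) * eLpNorm (g k) p (μcube d)) ^ θ.toReal) ^
      (1/θ.toReal)

/-- The B-spline sum `q_𝐤 = Σ_{𝐬 ∈ I(𝐤)} c_{𝐤,𝐬} N_{𝐤,𝐬}` with given coefficients. -/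
noncomputable def bsplineSeriesTerm (ℓ : ℕ) {d : ℕ} (c : (Fin d → ℕ) → (Fin d → ℕ) → ℝ)
    (k : Fin d → ℕ) (x : Fin d → ℝ) : ℝ :=
  ∑ s ∈ Fintype.piFinset (fun j => Finset.range (ℓ * 2 ^ (k j))),
    c k s * ∏ j, Nks ℓ (k j) (s j : ℤ) (x j)

lemma shiftOp_zero (h : ℝ) (f : ℝ → ℝ) (x : ℝ) : shiftOp 0 h f x = 0 := by
  simp [shiftOp]

lemma shiftOp_add (P Q : LaurentPolynomial ℝ) (h : ℝ) (f : ℝ → ℝ) (x : ℝ) :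
    shiftOp (P + Q) h f x = shiftOp P h f x + shiftOp Q h f x := by
  simp only [shiftOp, AddMonoidAlgebra.coeff_add]
  exact Finsupp.sum_add_index' (by simp) (by intros; ring)

lemma shiftOp_single (s : ℤ) (c h : ℝ) (f : ℝ → ℝ) (x : ℝ) :
    shiftOp (.single s c) h f x = c * f (x + s * h) := by
  rw [shiftOp, AddMonoidAlgebra.coeff_single, Finsupp.sum_single_index (zero_mul _)]

lemma shiftOp_sum {ι : Type*} (t : Finset ι) (P : ι → LaurentPolynomial ℝ) (h : ℝ)
    (f : ℝ → ℝ) (x : ℝ) : shiftOp (∑ i ∈ t, P i) h f x = ∑ i ∈ t, shiftOp (P i) h f x :=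
  map_sum (AddMonoidHom.mk' (fun Q => shiftOp Q h f x) fun Q R => shiftOp_add Q R h f x) P t

lemma shiftOp_add_fun (P : LaurentPolynomial ℝ) (h : ℝ) (f g : ℝ → ℝ) (x : ℝ) :
    shiftOp P h (fun y => f y + g y) x = shiftOp P h f x + shiftOp P h g x := by
  simp only [shiftOp, mul_add, Finsupp.sum_add]

lemma shiftOp_zero_fun (P : LaurentPolynomial ℝ) (h : ℝ) (x : ℝ) :
    shiftOp P h (fun _ => 0) x = 0 := by
  simp [shiftOp]

/-- Multiplication of Laurent polynomials corresponds to composition of shift operators. -/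
lemma shiftOp_mul (P Q : LaurentPolynomial ℝ) (h : ℝ) (f : ℝ → ℝ) (x : ℝ) :
    shiftOp (P * Q) h f x = shiftOp Q h (shiftOp P h f) x := by
  induction P using AddMonoidAlgebra.induction_linear with
  | zero =>
    rw [zero_mul, shiftOp_zero, show shiftOp 0 h f = fun _ => 0 from
      funext fun y => shiftOp_zero h f y, shiftOp_zero_fun]
  | add P₁ P₂ h₁ h₂ =>
    rw [add_mul, shiftOp_add, h₁, h₂, ← shiftOp_add_fun]
    congr 1
    exact funext fun y => (shiftOp_add P₁ P₂ h f y).symm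
  | single s c =>
    induction Q using AddMonoidAlgebra.induction_linear with
    | zero => rw [mul_zero, shiftOp_zero, shiftOp_zero]
    | add Q₁ Q₂ h₁ h₂ => rw [mul_add, shiftOp_add, h₁, h₂, shiftOp_add]
    | single r d =>
      rw [AddMonoidAlgebra.single_mul_single, shiftOp_single, shiftOp_single, shiftOp_single,
        show x + ((s + r : ℤ) : ℝ) * h = x + r * h + s * h by push_cast; ring]
      ring

/-- The difference operator `Δ_h^ℓ` is the shift operator generated by `(z - 1)^ℓ`. -/
lemma shiftOp_T_sub_one_pow (ℓ : ℕ) (h : ℝ) (f : ℝ → ℝ) :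
    shiftOp ((LaurentPolynomial.T 1 - 1) ^ ℓ) h f = deltaOp ℓ h f := by
  funext x
  rw [sub_eq_add_neg, add_pow, shiftOp_sum, deltaOp]
  refine Finset.sum_congr rfl fun j _ => ?_
  have key : (LaurentPolynomial.T 1 ^ j * (-1) ^ (ℓ - j) * (ℓ.choose j : LaurentPolynomial ℝ)) =
      .single (j : ℤ) ((-1 : ℝ) ^ (ℓ - j) * (ℓ.choose j : ℝ)) := by
    rw [LaurentPolynomial.single_eq_C_mul_T, LaurentPolynomial.T_pow]
    simp only [map_mul, map_pow, map_neg, map_one, map_natCast, mul_one]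
    ring
  rw [key, shiftOp_single, Int.cast_natCast]

lemma shiftOp_toLaurent (p : Polynomial ℝ) (h : ℝ) (f : ℝ → ℝ) (x : ℝ) :
    shiftOp (Polynomial.toLaurent p) h f x = p.sum fun k c => c * f (x + k * h) := by
  conv_lhs => rw [p.as_sum_support_C_mul_X_pow]
  rw [map_sum, shiftOp_sum, Polynomial.sum]
  refine Finset.sum_congr rfl fun k _ => ?_
  rw [Polynomial.toLaurent_C_mul_X_pow, ← LaurentPolynomial.single_eq_C_mul_T, shiftOp_single,
    Int.cast_natCast]

/-- Evaluating the shift operator on a rescaled falling factorial of degree `d` yields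
`d!` times the `d`-th Taylor coefficient at `1`. -/
lemma shiftOp_toLaurent_descPochhammer (p : Polynomial ℝ) {h : ℝ} (hh : h ≠ 0) (d : ℕ) :
    shiftOp (Polynomial.toLaurent p) h
      (fun y => ((descPochhammer ℝ d).comp (Polynomial.C h⁻¹ * Polynomial.X)).eval y) 0 =
      d.factorial * (Polynomial.taylor 1 p).coeff d := by
  rw [shiftOp_toLaurent, Polynomial.taylor_coeff, Polynomial.hasseDeriv_apply, Polynomial.sum,
    Polynomial.sum, Polynomial.eval_finsetSum, Finset.mul_sum]
  refine Finset.sum_congr rfl fun k _ => ?_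
  have hk : h⁻¹ * (0 + k * h) = k := by field_simp; ring
  rw [Polynomial.eval_comp, Polynomial.eval_mul, Polynomial.eval_C, Polynomial.eval_X, hk,
    descPochhammer_eval_eq_descFactorial, Nat.descFactorial_eq_factorial_mul_choose,
    Polynomial.eval_monomial]
  push_cast
  ring

lemma X_sub_one_pow_dvd_of_shiftOp_eq_zero {ℓ : ℕ} {h : ℝ} (hh : h ≠ 0) (p : Polynomial ℝ)
    (hp : ∀ g : Polynomial ℝ, g.degree < (ℓ : WithBot ℕ) →
      shiftOp (Polynomial.toLaurent p) h (fun y => Polynomial.eval y g) 0 = 0) :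
    (Polynomial.X - Polynomial.C 1) ^ ℓ ∣ p := by
  rw [Polynomial.X_sub_C_pow_dvd_iff, ← Polynomial.taylor_apply, Polynomial.X_pow_dvd_iff]
  intro d hd
  have hdeg : ((descPochhammer ℝ d).comp (Polynomial.C h⁻¹ * Polynomial.X)).degree <
      (ℓ : WithBot ℕ) := by
    refine Polynomial.degree_le_natDegree.trans_lt ?_
    rw [Polynomial.natDegree_comp, descPochhammer_natDegree,
      Polynomial.natDegree_C_mul_X _ (inv_ne_zero hh), mul_one]
    exact_mod_cast hd
  have h0 := hp _ hdeg
  rw [shiftOp_toLaurent_descPochhammer p hh] at h0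
  exact (mul_eq_zero.mp h0).resolve_left (by exact_mod_cast d.factorial_ne_zero)

/-- if `T_h^{[P]}` annihilates all polynomials of degree at most `ℓ-1`, then
`(z-1)^ℓ` divides `P` in `ℝ[z,z⁻¹]`, and `T_h^{[P]}(f) = T_h^{[P*]}(Δ_h^ℓ f)` for all `f`. -/
theorem laurent_factorization_of_annihilating_operator
    (ℓ : ℕ) (h : ℝ) (hh : h ≠ 0) (P : LaurentPolynomial ℝ)
    (hP : ∀ g : Polynomial ℝ, g.degree < (ℓ : WithBot ℕ) →
      ∀ x : ℝ, shiftOp P h (fun y => Polynomial.eval y g) x = 0) :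
    ((LaurentPolynomial.T 1 - 1) ^ ℓ : LaurentPolynomial ℝ) ∣ P ∧
    ∃ Pstar : LaurentPolynomial ℝ,
      P = (LaurentPolynomial.T 1 - 1) ^ ℓ * Pstar ∧
      ∀ (f : ℝ → ℝ) (x : ℝ), shiftOp P h f x = shiftOp Pstar h (deltaOp ℓ h f) x := by
  have hdvd : ((LaurentPolynomial.T 1 - 1) ^ ℓ : LaurentPolynomial ℝ) ∣ P := by
    obtain ⟨n, p, hp⟩ := LaurentPolynomial.exists_T_pow P
    have hzero : ∀ g : Polynomial ℝ, g.degree < (ℓ : WithBot ℕ) →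
        shiftOp (Polynomial.toLaurent p) h (fun y => Polynomial.eval y g) 0 = 0 := by
      intro g hg
      rw [hp, shiftOp_mul, LaurentPolynomial.T, shiftOp_single, hP g hg, mul_zero]
    have hmap := map_dvd Polynomial.toLaurent (X_sub_one_pow_dvd_of_shiftOp_eq_zero hh p hzero)
    rw [hp, map_pow, map_sub, Polynomial.toLaurent_X, map_one, Polynomial.toLaurent_one] at hmap
    exact (LaurentPolynomial.isUnit_T n).dvd_mul_right.mp hmap
  obtain ⟨Q, hQ⟩ := hdvd
  refine ⟨⟨Q, hQ⟩, Q, hQ, fun f x => ?_⟩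
  rw [hQ, shiftOp_mul, shiftOp_T_sub_one_pow]
end
end

section
/- Let ℓ ∈ ℕ be even and let Q be a quasi-interpolation operator induced by an even sequence Λ = (λ(j))_{|j|≤μ}, μ ≥ ℓ/2 - 1. Then for every continuous function f on the torus 𝕋^d, ‖f - Q_𝐤(f)‖_{C(𝕋^d)} → 0 as min_i k_i → ∞; equivalently, every f ∈ C(𝕋^d) is represented as f = Σ_{𝐤∈ℤ≥0^d} q_𝐤(f), the rectangular partial sums Σ_{𝐤'≤𝐤} q_{𝐤'}(f) = Q_𝐤(f) converging uniformly on 𝕋^d. -/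
open MeasureTheory Finset
open scoped ENNReal
noncomputable section

/-- The cardinal B-spline of order `ℓ` vanishes outside `[0, ℓ)`. -/
theorem bspline_eq_zero (ℓ : ℕ) (x : ℝ) (hx : x < 0 ∨ (ℓ : ℝ) ≤ x) : bspline ℓ x = 0 := by
  induction ℓ using Nat.twoStepInduction generalizing x with
  | zero => rfl
  | one =>
    simp only [bspline, ite_eq_right_iff, one_ne_zero, imp_false, not_and, not_lt]
    rcases hx with hx | hx
    · intro h; linarith
    · intro; simpa using hx
  | more n _ ih =>
    simp only [bspline]
    rw [intervalIntegral.integral_congr (g := fun _ => (0 : ℝ))]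
    · simp
    · intro t ht
      rw [Set.uIcc_of_le zero_le_one] at ht
      refine ih _ ?_
      rcases hx with hx | hx
      · left; linarith [ht.1]
      · right; push_cast at hx ⊢; linarith [ht.2]

theorem abs_bspline_le_one (ℓ : ℕ) (x : ℝ) : |bspline ℓ x| ≤ 1 := by
  induction ℓ using Nat.twoStepInduction generalizing x with
  | zero => simp [bspline]
  | one => simp only [bspline]; split_ifs <;> simp
  | more n _ ih =>
    have h := intervalIntegral.norm_integral_le_of_norm_le_const (a := 0) (b := 1) (C := 1)
      (f := fun t => bspline (n + 1) (x - t)) fun t _ => ih (x - t)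
    simpa [bspline] using h

/-- The integers `s` for which `y - s` can lie in the support of the B-spline of order `ℓ`. -/
def splineWindow (ℓ : ℕ) (y : ℝ) : Finset ℤ := Finset.Icc (⌊y⌋ - ℓ) ⌊y⌋

theorem bspline_sub_eq_zero {ℓ : ℕ} {y : ℝ} {s : ℤ} (hs : s ∉ splineWindow ℓ y) :
    bspline ℓ (y - s) = 0 := by
  apply bspline_eq_zero
  simp only [splineWindow, Finset.mem_Icc, not_and_or, not_le] at hs
  rcases hs with hs | hs
  · right
    have h : (s : ℝ) + ℓ ≤ ⌊y⌋ := by exact_mod_cast (by omega : s + ℓ ≤ ⌊y⌋)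
    linarith [Int.floor_le y]
  · left
    linarith [Int.floor_lt.mp hs]

theorem abs_sub_le_of_mem_splineWindow {ℓ : ℕ} {y : ℝ} {s : ℤ} (hs : s ∈ splineWindow ℓ y) :
    |y - s| ≤ ℓ + 1 := by
  simp only [splineWindow, Finset.mem_Icc] at hs
  have h₁ : (⌊y⌋ : ℝ) - ℓ ≤ s := by exact_mod_cast hs.1
  have h₂ : (s : ℝ) ≤ ⌊y⌋ := by exact_mod_cast hs.2
  rw [abs_le]
  constructor <;> linarith [Int.floor_le y, Int.lt_floor_add_one y, (Nat.cast_nonneg ℓ : (0:ℝ) ≤ ℓ)]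

theorem card_splineWindow (ℓ : ℕ) (y : ℝ) : (splineWindow ℓ y).card = ℓ + 1 := by
  simp only [splineWindow, Int.card_Icc]
  omega

theorem tsum_mul_bspline (ℓ : ℕ) (c : ℤ → ℝ) (y : ℝ) :
    ∑' s : ℤ, c s * bspline ℓ (y - s) = ∑ s ∈ splineWindow ℓ y, c s * bspline ℓ (y - s) :=
  tsum_eq_sum fun s hs => by rw [bspline_sub_eq_zero hs, mul_zero]

theorem abs_tsum_mul_bspline_le (ℓ : ℕ) (c : ℤ → ℝ) (y : ℝ) {B : ℝ}
    (hc : ∀ s ∈ splineWindow ℓ y, |c s| ≤ B) :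
    |∑' s : ℤ, c s * bspline ℓ (y - s)| ≤ (ℓ + 1) * B := by
  rw [tsum_mul_bspline]
  calc |∑ s ∈ splineWindow ℓ y, c s * bspline ℓ (y - s)|
      ≤ ∑ s ∈ splineWindow ℓ y, |c s * bspline ℓ (y - s)| := Finset.abs_sum_le_sum_abs _ _
    _ ≤ ∑ s ∈ splineWindow ℓ y, B := by
        refine Finset.sum_le_sum fun s hs => ?_
        rw [abs_mul]
        exact (mul_le_of_le_one_right (abs_nonneg _) (abs_bspline_le_one ℓ _)).trans (hc s hs)
    _ = (ℓ + 1) * B := by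
        rw [Finset.sum_const, card_splineWindow, nsmul_eq_mul]; push_cast; rfl

/-- The bound `Σ_{|j|≤μ} |λ(j)|` on the coefficient functional. -/
def lamNorm (μ : ℕ) (lam : ℤ → ℝ) : ℝ := ∑ j ∈ Finset.Icc (-(μ:ℤ)) (μ:ℤ), |lam j|

theorem lamNorm_nonneg (μ : ℕ) (lam : ℤ → ℝ) : 0 ≤ lamNorm μ lam :=
  Finset.sum_nonneg fun _ _ => abs_nonneg _

theorem abs_sum_lam_mul_le (μ : ℕ) (lam : ℤ → ℝ) (g : ℤ → ℝ) {B : ℝ}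
    (hg : ∀ j ∈ Finset.Icc (-(μ:ℤ)) (μ:ℤ), |g j| ≤ B) :
    |∑ j ∈ Finset.Icc (-(μ:ℤ)) (μ:ℤ), lam j * g j| ≤ lamNorm μ lam * B := by
  rw [lamNorm, Finset.sum_mul]
  refine (Finset.abs_sum_le_sum_abs _ _).trans (Finset.sum_le_sum fun j hj => ?_)
  rw [abs_mul]
  exact mul_le_mul_of_nonneg_left (hg j hj) (abs_nonneg _)

section Coordinate

variable (ℓ μ : ℕ) (lam : ℤ → ℝ) {d : ℕ} (j : Fin d)

/-- `QkCoord` as a linear operator on functions. -/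
def QkCoordLin (k : ℕ) : Module.End ℝ ((Fin d → ℝ) → ℝ) where
  toFun := QkCoord ℓ μ lam j k
  map_add' f g := by
    ext x
    simp only [QkCoord, Pi.add_apply, tsum_mul_bspline]
    rw [← Finset.sum_add_distrib]
    refine Finset.sum_congr rfl fun s _ => ?_
    rw [← add_mul, ← Finset.sum_add_distrib]
    simp only [← mul_add]
  map_smul' c f := by
    ext x
    simp only [QkCoord, Pi.smul_apply, smul_eq_mul, tsum_mul_bspline, RingHom.id_apply]
    simp only [Finset.mul_sum, Finset.sum_mul]
    refine Finset.sum_congr rfl fun s _ => Finset.sum_congr rfl fun i _ => ?_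
    ring

/-- `qdiffCoord` as a linear operator on functions. -/
def qdiffCoordLin : ℕ → Module.End ℝ ((Fin d → ℝ) → ℝ)
  | 0 => QkCoordLin ℓ μ lam j 0
  | (k + 1) => QkCoordLin ℓ μ lam j (k + 1) - QkCoordLin ℓ μ lam j k

theorem qdiffCoordLin_apply (k : ℕ) (f : (Fin d → ℝ) → ℝ) :
    qdiffCoordLin ℓ μ lam j k f = qdiffCoord ℓ μ lam j k f := by
  cases k <;> rfl

theorem sum_qdiffCoordLin (k : ℕ) :
    ∑ i ∈ Finset.range (k + 1), qdiffCoordLin ℓ μ lam j i = QkCoordLin ℓ μ lam j k := by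
  induction k with
  | zero => simp [qdiffCoordLin]
  | succ k ih => rw [Finset.sum_range_succ, ih, qdiffCoordLin, add_sub_cancel]

variable {ℓ μ lam j}

theorem abs_QkCoord_le (k : ℕ) {f : (Fin d → ℝ) → ℝ} {B : ℝ} (hf : ∀ x, |f x| ≤ B)
    (x : Fin d → ℝ) : |QkCoord ℓ μ lam j k f x| ≤ (ℓ + 1) * (lamNorm μ lam * B) :=
  abs_tsum_mul_bspline_le ℓ _ _ fun _ _ => abs_sum_lam_mul_le μ lam _ fun _ _ => hf _

end Coordinate

theorem list_prod_map_apply {ι V : Type*} [AddCommGroup V] [Module ℝ V]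
    (A : ι → Module.End ℝ V) (l : List ι) (v : V) :
    (l.map A).prod v = l.foldr (fun i w => A i w) v := by
  induction l with
  | nil => rfl
  | cons i l ih => rw [List.map_cons, List.prod_cons, Module.End.mul_apply, ih, List.foldr_cons]

theorem Qmix_eq_sum_qmix (ℓ μ : ℕ) (lam : ℤ → ℝ) {d : ℕ} (k : Fin d → ℕ)
    (f : (Fin d → ℝ) → ℝ) :
    Qmix ℓ μ lam k f =
      ∑ k' ∈ Fintype.piFinset (fun j => Finset.range (k j + 1)), qmix ℓ μ lam k' f := by
  have hQ : Qmix ℓ μ lam k f = (List.ofFn fun j => QkCoordLin ℓ μ lam j (k j)).prod f := by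
    rw [List.ofFn_eq_map, list_prod_map_apply]; rfl
  have hq (k' : Fin d → ℕ) :
      qmix ℓ μ lam k' f = (List.ofFn fun j => qdiffCoordLin ℓ μ lam j (k' j)).prod f := by
    rw [List.ofFn_eq_map, list_prod_map_apply]
    simp only [qdiffCoordLin_apply]
    rfl
  have h := (MultilinearMap.mkPiAlgebraFin ℝ d (Module.End ℝ ((Fin d → ℝ) → ℝ))).map_sum_finset
    (fun j i => qdiffCoordLin ℓ μ lam j i) (fun j => Finset.range (k j + 1))
  simp only [MultilinearMap.mkPiAlgebraFin_apply, sum_qdiffCoordLin] at h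
  simp only [hQ, hq, h, LinearMap.sum_apply]

section UniformContinuity

variable {d : ℕ} {f : (Fin d → ℝ) → ℝ}

theorem PeriodicTd.periodic_intCast (hf : PeriodicTd f) (n : Fin d → ℤ) :
    Function.Periodic f (fun j => (n j : ℝ)) := by
  have hsum : (fun j => (n j : ℝ)) = ∑ j, n j • (Pi.single j 1 : Fin d → ℝ) := by
    ext i
    simp [Finset.sum_apply, Pi.single_apply]
  rw [hsum]
  refine Finset.sum_induction _ (Function.Periodic f) (fun _ _ => Function.Periodic.add_period)
    (fun x => by rw [add_zero]) fun j _ => Function.Periodic.zsmul (fun x => ?_) (n j)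
  rw [← hf x j]
  congr 1
  ext i
  by_cases h : i = j
  · subst h; simp
  · simp [h]

theorem PeriodicTd.uniformContinuous (hf : PeriodicTd f) (hc : Continuous f) :
    UniformContinuous f := by
  have hK : IsCompact (Set.univ.pi fun _ : Fin d => Set.Icc (-1 : ℝ) 2) :=
    isCompact_univ_pi fun _ => isCompact_Icc
  have hu := hK.uniformContinuousOn_of_continuous hc.continuousOn
  rw [Metric.uniformContinuousOn_iff] at hu
  rw [Metric.uniformContinuous_iff]
  intro ε hε
  obtain ⟨δ, hδ, h⟩ := hu ε hε
  refine ⟨min δ 1, lt_min hδ one_pos, fun {x y} hxy => ?_⟩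
  set n : Fin d → ℝ := fun j => ((-⌊x j⌋ : ℤ) : ℝ)
  have hn : Function.Periodic f n := hf.periodic_intCast fun j => -⌊x j⌋
  rw [← hn x, ← hn y]
  have hx (j : Fin d) : 0 ≤ x j + n j ∧ x j + n j ≤ 1 := by
    simp only [n, Int.cast_neg]
    constructor <;> linarith [Int.floor_le (x j), Int.lt_floor_add_one (x j)]
  have hd (j : Fin d) : |x j - y j| < 1 :=
    (dist_le_pi_dist x y j).trans_lt (hxy.trans_le (min_le_right _ _))
  refine h _ (fun j _ => ?_) _ (fun j _ => ?_) ?_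
  · exact ⟨by simp only [Pi.add_apply]; linarith [(hx j).1],
      by simp only [Pi.add_apply]; linarith [(hx j).2]⟩
  · have := abs_lt.mp (hd j)
    exact ⟨by simp only [Pi.add_apply]; linarith [(hx j).1],
      by simp only [Pi.add_apply]; linarith [(hx j).2]⟩
  · rw [dist_add_right]
    exact hxy.trans_le (min_le_left _ _)

end UniformContinuity

section Convergence

variable {ℓ μ : ℕ} {lam : ℤ → ℝ} {d : ℕ} {f : (Fin d → ℝ) → ℝ}

theorem IsQuasiInterp.tsum_lam_mul_bspline (hQI : IsQuasiInterp ℓ μ lam) (hℓ : 0 < ℓ) (y : ℝ) :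
    ∑' s : ℤ, (∑ j ∈ Finset.Icc (-(μ:ℤ)) (μ:ℤ), lam j) * bspline ℓ (y - s) = 1 := by
  simpa [Qbase] using hQI 1 (by rw [Polynomial.degree_one]; exact_mod_cast hℓ) y

theorem IsQuasiInterp.sub_QkCoord_eq (hQI : IsQuasiInterp ℓ μ lam) (hℓ : 0 < ℓ) (j : Fin d)
    (k : ℕ) (f : (Fin d → ℝ) → ℝ) (x : Fin d → ℝ) :
    f x - QkCoord ℓ μ lam j k f x =
      ∑' s : ℤ, (∑ i ∈ Finset.Icc (-(μ:ℤ)) (μ:ℤ), lam i *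
        (f x - f (Function.update x j (hstep ℓ k * ((s:ℝ) - (i:ℝ) + (ℓ:ℝ)/2))))) *
      bspline ℓ ((ℓ:ℝ) * 2^k * x j - (s:ℝ)) := by
  have h := hQI.tsum_lam_mul_bspline hℓ ((ℓ:ℝ) * 2^k * x j)
  rw [tsum_mul_bspline] at h
  simp only [QkCoord, tsum_mul_bspline]
  simp only [mul_sub, Finset.sum_sub_distrib, sub_mul]
  congr 1
  calc f x = f x * 1 := (mul_one _).symm
    _ = _ := by
      rw [← h, Finset.mul_sum]
      exact Finset.sum_congr rfl fun s _ => by rw [← Finset.sum_mul]; ring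

theorem abs_node_sub_le (hℓ : 0 < ℓ) (k : ℕ) {t : ℝ} {s i : ℤ}
    (hs : s ∈ splineWindow ℓ ((ℓ:ℝ) * 2^k * t)) (hi : i ∈ Finset.Icc (-(μ:ℤ)) (μ:ℤ)) :
    |t - hstep ℓ k * ((s:ℝ) - (i:ℝ) + (ℓ:ℝ)/2)| ≤ (2 * ℓ + 1 + μ) * (1 / 2) ^ k := by
  have hℓ' : (1 : ℝ) ≤ ℓ := by exact_mod_cast hℓ
  have h₁ := abs_sub_le_of_mem_splineWindow hs
  rw [Finset.mem_Icc] at hi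
  have hi' : |(i : ℝ)| ≤ μ := abs_le.mpr ⟨by exact_mod_cast hi.1, by exact_mod_cast hi.2⟩
  have hstep_nonneg : 0 ≤ hstep ℓ k := by unfold hstep; positivity
  have hstep_le : hstep ℓ k ≤ (1 / 2) ^ k := by
    rw [hstep, one_div, inv_pow]
    exact mul_le_of_le_one_left (by positivity) (inv_le_one_of_one_le₀ hℓ')
  have heq : t - hstep ℓ k * ((s:ℝ) - (i:ℝ) + (ℓ:ℝ)/2) =
      hstep ℓ k * (((ℓ:ℝ) * 2^k * t - s) + i - ℓ / 2) := by
    unfold hstep; field_simp; ring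
  rw [heq, abs_mul, abs_of_nonneg hstep_nonneg, mul_comm]
  refine mul_le_mul ?_ hstep_le hstep_nonneg (by positivity)
  rw [abs_le] at *
  constructor <;> linarith [h₁.1, h₁.2, hi'.1, hi'.2]

theorem IsQuasiInterp.exists_abs_sub_QkCoord_le (hQI : IsQuasiInterp ℓ μ lam) (hℓ : 0 < ℓ)
    (hf : UniformContinuous f) (j : Fin d) {ε : ℝ} (hε : 0 < ε) :
    ∃ K : ℕ, ∀ k, K ≤ k → ∀ x, |f x - QkCoord ℓ μ lam j k f x| ≤ ε := by
  have hL := lamNorm_nonneg μ lam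
  set C : ℝ := (ℓ + 1) * lamNorm μ lam + 1
  have hC : 0 < C := by positivity
  obtain ⟨δ, hδ, h⟩ := Metric.uniformContinuous_iff.mp hf (ε / C) (by positivity)
  have hlim : Filter.Tendsto (fun k : ℕ => (2 * (ℓ : ℝ) + 1 + μ) * (1 / 2) ^ k) Filter.atTop
      (nhds 0) := by
    simpa using (tendsto_pow_atTop_nhds_zero_of_lt_one (r := (1 / 2 : ℝ)) (by norm_num)
      (by norm_num)).const_mul (2 * (ℓ : ℝ) + 1 + μ)
  obtain ⟨K, hK⟩ := Filter.eventually_atTop.mp (hlim.eventually_lt_const hδ)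
  refine ⟨K, fun k hk x => ?_⟩
  rw [hQI.sub_QkCoord_eq hℓ]
  refine (abs_tsum_mul_bspline_le ℓ _ _ fun s hs => abs_sum_lam_mul_le μ lam _ fun i hi =>
    (h (a := x) ?_).le).trans ?_
  · refine lt_of_le_of_lt ((dist_pi_le_iff (by positivity)).mpr fun i' => ?_) (hK k hk)
    by_cases hij : i' = j
    · subst hij
      rw [Function.update_self, Real.dist_eq]
      exact abs_node_sub_le hℓ k hs hi
    · rw [Function.update_of_ne hij, dist_self]
      positivity
  · rw [← mul_assoc, ← mul_div_assoc, div_le_iff₀ hC, mul_comm]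
    exact mul_le_mul_of_nonneg_left (by simp [C]) hε.le

theorem IsQuasiInterp.exists_abs_sub_foldr_QkCoord_le (hQI : IsQuasiInterp ℓ μ lam) (hℓ : 0 < ℓ)
    (hf : UniformContinuous f) (l : List (Fin d)) {ε : ℝ} (hε : 0 < ε) :
    ∃ K : ℕ, ∀ k : Fin d → ℕ, (∀ i, K ≤ k i) →
      ∀ x, |f x - l.foldr (fun j g => QkCoord ℓ μ lam j (k j) g) f x| ≤ ε := by
  induction l generalizing ε with
  | nil => exact ⟨0, fun k _ x => by simpa using hε.le⟩
  | cons j l ih =>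
    have hL := lamNorm_nonneg μ lam
    set C : ℝ := (ℓ + 1) * lamNorm μ lam + 1
    have hC : 0 < C := by positivity
    obtain ⟨K₁, h₁⟩ := hQI.exists_abs_sub_QkCoord_le hℓ hf j (half_pos hε)
    obtain ⟨K₂, h₂⟩ := ih (ε := ε / 2 / C) (by positivity)
    refine ⟨max K₁ K₂, fun k hk x => ?_⟩
    set g := l.foldr (fun j g => QkCoord ℓ μ lam j (k j) g) f
    have hsplit : f x - QkCoord ℓ μ lam j (k j) g x =
        (f x - QkCoord ℓ μ lam j (k j) f x) + QkCoord ℓ μ lam j (k j) (f - g) x := by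
      have := congrFun (map_sub (QkCoordLin ℓ μ lam j (k j)) f g) x
      change QkCoord ℓ μ lam j (k j) (f - g) x =
        QkCoord ℓ μ lam j (k j) f x - QkCoord ℓ μ lam j (k j) g x at this
      rw [this]; ring
    have hbound : |QkCoord ℓ μ lam j (k j) (f - g) x| ≤ ε / 2 := by
      refine (abs_QkCoord_le (k j)
        (h₂ k fun i => (le_max_right _ _).trans (hk i)) x).trans ?_
      rw [← mul_assoc, ← mul_div_assoc, div_le_iff₀ hC, mul_comm]
      exact mul_le_mul_of_nonneg_left (by simp [C]) (half_pos hε).le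
    rw [List.foldr_cons, hsplit]
    refine (abs_add_le _ _).trans ?_
    linarith [h₁ (k j) ((le_max_left _ _).trans (hk j)) x]

end Convergence

/-- for every continuous function on the torus, `‖f - Q_𝐤(f)‖_∞ → 0` as
`min_i k_i → ∞`; the rectangular partial sums of the series `Σ_𝐤 q_𝐤(f)` equal `Q_𝐤(f)`,
so `f = Σ_𝐤 q_𝐤(f)` with uniform convergence. -/
theorem Qmix_uniform_convergence (ℓ μ d : ℕ) (hℓe : Even ℓ) (hℓ : 0 < ℓ) (hd : 0 < d)
    (hμ : ℓ/2 - 1 ≤ μ) (lam : ℤ → ℝ) (hlam : IsEvenSeq lam) (hQI : IsQuasiInterp ℓ μ lam)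
    (f : (Fin d → ℝ) → ℝ) (hfc : Continuous f) (hfp : PeriodicTd f) :
    (∀ (k : Fin d → ℕ) (x : Fin d → ℝ), Qmix ℓ μ lam k f x
        = ∑ k' ∈ Fintype.piFinset (fun j => Finset.range (k j + 1)), qmix ℓ μ lam k' f x) ∧
    ∀ ε : ℝ, 0 < ε → ∃ K : ℕ, ∀ k : Fin d → ℕ, (∀ i, K ≤ k i) →
      ∀ x : Fin d → ℝ, |f x - Qmix ℓ μ lam k f x| ≤ ε := by
  exact ⟨fun k x => by rw [Qmix_eq_sum_qmix, Finset.sum_apply], fun ε hε =>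
    hQI.exists_abs_sub_foldr_QkCoord_le hℓ (hfp.uniformContinuous hfc) (List.finRange d) hε⟩
end
end

section
/- Let ℓ ∈ ℕ be even and let Q be a quasi-interpolation operator induced by an even sequence Λ = (λ(j))_{|j|≤μ}, μ ≥ ℓ/2 - 1 (i.e., Q reproduces all polynomials of degree at most ℓ-1). Then (z-1)^ℓ divides both P_even and P_odd in ℝ[z,z⁻¹]: there exist symmetric Laurent polynomials P*_even and P*_odd with P_even(z) = (z-1)^ℓ P*_even(z) and P_odd(z) = (z-1)^ℓ P*_odd(z). -/
open MeasureTheory Finset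
open scoped ENNReal
noncomputable section

/-! ### Regularity, support and refinement equation of the cardinal B-splines -/

theorem bspline_succ_eq_integral (n : ℕ) (x : ℝ) :
    bspline (n + 2) x = ∫ u in (x - 1)..x, bspline (n + 1) u := by
  rw [bspline, intervalIntegral.integral_comp_sub_left (fun u => bspline (n + 1) u) x, sub_zero]

theorem intervalIntegrable_bspline (n : ℕ) (a b : ℝ) :
    IntervalIntegrable (bspline (n + 1)) volume a b := by
  induction n generalizing a b with
  | zero =>
    have h : bspline (0 + 1) = Set.indicator (Set.Ico (0 : ℝ) 1) (fun _ => (1 : ℝ)) := by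
      ext x
      simp [bspline, Set.indicator_apply]
    rw [h]
    have hi : Integrable (Set.indicator (Set.Ico (0 : ℝ) 1) (fun _ => (1 : ℝ))) volume :=
      (integrable_indicator_iff measurableSet_Ico).2 (integrableOn_const (by simp))
    exact hi.intervalIntegrable
  | succ n ih =>
    have hc : Continuous (fun x => ∫ u in (0 : ℝ)..x, bspline (n + 1) u) :=
      intervalIntegral.continuous_primitive ih 0
    have h : bspline (n + 1 + 1) = fun x => (∫ u in (0 : ℝ)..x, bspline (n + 1) u) -
        ∫ u in (0 : ℝ)..(x - 1), bspline (n + 1) u := by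
      ext x
      rw [bspline_succ_eq_integral, intervalIntegral.integral_interval_sub_left (ih _ _) (ih _ _)]
    rw [h]
    exact (hc.sub (hc.comp (by fun_prop : Continuous fun x : ℝ => x - 1))).intervalIntegrable a b

theorem bspline_eq_zero_of_notMem (n : ℕ) {x : ℝ} (hx : x ∉ Set.Icc (0 : ℝ) n) :
    bspline n x = 0 := by
  match n with
  | 0 => simp [bspline]
  | 1 =>
    rw [bspline, if_neg]
    rintro ⟨h0, h1⟩
    exact hx ⟨h0, by exact_mod_cast h1.le⟩
  | n + 2 =>
    rw [bspline]
    refine (intervalIntegral.integral_congr fun t ht => ?_).trans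
      intervalIntegral.integral_zero
    rw [Set.uIcc_of_le zero_le_one] at ht
    refine bspline_eq_zero_of_notMem (n + 1) fun h => hx ?_
    have h1 := h.1
    have h2 := h.2
    push_cast at h2 ⊢
    constructor <;> linarith [ht.1, ht.2]

theorem integral_bspline_two_mul (n : ℕ) (y : ℝ) :
    ∫ t in (0 : ℝ)..1, bspline (n + 1) (y - 2 * t) =
      2⁻¹ * (bspline (n + 2) y + bspline (n + 2) (y - 1)) := by
  rw [intervalIntegral.integral_comp_sub_mul (fun u => bspline (n + 1) u) two_ne_zero,
    bspline_succ_eq_integral, bspline_succ_eq_integral,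
    add_comm (∫ u in (y - 1)..y, bspline (n + 1) u),
    intervalIntegral.integral_add_adjacent_intervals (intervalIntegrable_bspline n _ _)
      (intervalIntegrable_bspline n _ _), smul_eq_mul]
  norm_num [sub_sub]

theorem sum_choose_mul_add_shift (n : ℕ) (F : ℕ → ℝ) :
    ∑ j ∈ range (n + 1), (n.choose j : ℝ) * (F j + F (j + 1)) =
      ∑ j ∈ range (n + 2), ((n + 1).choose j : ℝ) * F j := by
  rw [Finset.sum_range_succ' _ (n + 1)]
  simp only [Nat.choose_succ_succ, Nat.cast_add, add_mul, Finset.sum_add_distrib, mul_add]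
  have h := Finset.sum_range_succ' (fun j => (n.choose j : ℝ) * F j) (n + 1)
  rw [Finset.sum_range_succ _ (n + 1)] at h
  simp at h ⊢
  linarith

/-- The refinement equation of the cardinal B-spline. -/
theorem bspline_refinement (n : ℕ) (x : ℝ) :
    bspline (n + 1) x = ((2 : ℝ) ^ n)⁻¹ *
      ∑ j ∈ range (n + 2), ((n + 1).choose j : ℝ) * bspline (n + 1) (2 * x - j) := by
  induction n generalizing x with
  | zero =>
    simp only [bspline, Finset.sum_range_succ, Finset.sum_range_zero]
    norm_num
    split_ifs <;> grind
  | succ n ih =>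
    have hint (j : ℕ) : IntervalIntegrable (fun t => bspline (n + 1) (2 * x - j - 2 * t))
        volume 0 1 := by
      have h := ((intervalIntegrable_bspline n (2 * x - j) (2 * x - j - 2)).comp_sub_left
        (2 * x - j)).comp_mul_left (c := 2)
      simpa using h
    calc bspline (n + 2) x = ∫ t in (0 : ℝ)..1, bspline (n + 1) (x - t) := by rw [bspline]
      _ = ∫ t in (0 : ℝ)..1, ((2 : ℝ) ^ n)⁻¹ * ∑ j ∈ range (n + 2),
            ((n + 1).choose j : ℝ) * bspline (n + 1) (2 * x - j - 2 * t) := by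
          refine intervalIntegral.integral_congr fun t _ => ?_
          rw [ih]
          congr! 4
          ring
      _ = ((2 : ℝ) ^ n)⁻¹ * ∑ j ∈ range (n + 2), ((n + 1).choose j : ℝ) *
            (2⁻¹ * (bspline (n + 2) (2 * x - j) + bspline (n + 2) (2 * x - j - 1))) := by
          rw [intervalIntegral.integral_const_mul, intervalIntegral.integral_finsetSum
            fun j _ => (hint j).const_mul _]
          simp only [intervalIntegral.integral_const_mul, integral_bspline_two_mul]
      _ = _ := by
          have h := sum_choose_mul_add_shift (n + 1) fun j => bspline (n + 2) (2 * x - j)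
          rw [← h, pow_succ, mul_inv, mul_assoc, Finset.mul_sum (a := (2 : ℝ)⁻¹)]
          push_cast
          simp only [sub_sub, mul_left_comm]

/-! ### Laurent polynomials acting on functions by translations -/

/-- The action of `ℝ[z,z⁻¹]` on functions `ℝ → ℝ` in which `z^n` acts as `f ↦ f(· + n)`. -/
def translationAction : LaurentPolynomial ℝ →ₐ[ℝ] Module.End ℝ (ℝ → ℝ) :=
  AddMonoidAlgebra.lift ℝ (Module.End ℝ (ℝ → ℝ)) ℤ
    { toFun := fun n => LinearMap.funLeft ℝ ℝ fun x => x + (n.toAdd : ℝ)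
      map_one' := by
        ext f x
        simp [LinearMap.funLeft_apply]
      map_mul' := fun m n => by
        ext f x
        simp [LinearMap.funLeft_apply, add_assoc] }

theorem translationAction_T (n : ℤ) (f : ℝ → ℝ) (x : ℝ) :
    translationAction (LaurentPolynomial.T n) f x = f (x + n) := by
  rw [translationAction, LaurentPolynomial.T, AddMonoidAlgebra.lift_single, one_smul]
  rfl

theorem translationAction_C_mul (r : ℝ) (P : LaurentPolynomial ℝ) (f : ℝ → ℝ) (x : ℝ) :
    translationAction (LaurentPolynomial.C r * P) f x = r * translationAction P f x := by
  rw [← LaurentPolynomial.smul_eq_C_mul, map_smul]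
  rfl

theorem translationAction_mul_apply (P R : LaurentPolynomial ℝ) (f : ℝ → ℝ) :
    translationAction (P * R) f = translationAction P (translationAction R f) := by
  rw [map_mul]
  rfl

theorem translationAction_comm (P R : LaurentPolynomial ℝ) (f : ℝ → ℝ) :
    translationAction P (translationAction R f) = translationAction R (translationAction P f) := by
  rw [← translationAction_mul_apply, mul_comm, translationAction_mul_apply]

theorem translationAction_sum_apply {ι : Type*} (s : Finset ι) (P : ι → LaurentPolynomial ℝ)
    (f : ℝ → ℝ) (x : ℝ) :
    translationAction (∑ i ∈ s, P i) f x = ∑ i ∈ s, translationAction (P i) f x := by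
  rw [map_sum, LinearMap.sum_apply, Finset.sum_apply]

/-- The space of polynomial functions of degree `< n`. -/
def polyFun (n : ℕ) : Submodule ℝ (ℝ → ℝ) :=
  (Polynomial.degreeLT ℝ n).map (LinearMap.pi fun x => Polynomial.leval x)

theorem mem_polyFun {n : ℕ} {f : ℝ → ℝ} :
    f ∈ polyFun n ↔ ∃ p : Polynomial ℝ, p.degree < n ∧ f = fun x => p.eval x := by
  simp only [polyFun, Submodule.mem_map, Polynomial.mem_degreeLT]
  exact exists_congr fun p => and_congr_right fun _ => eq_comm

instance finiteDimensional_polyFun (n : ℕ) : FiniteDimensional ℝ (polyFun n) := by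
  have : FiniteDimensional ℝ (Polynomial.degreeLT ℝ n) :=
    Module.Finite.equiv (Polynomial.degreeLTEquiv ℝ n).symm
  unfold polyFun
  infer_instance

theorem comp_affine_mem_polyFun {n : ℕ} {f : ℝ → ℝ} (hf : f ∈ polyFun n) (a b : ℝ) :
    (fun x => f (a * x + b)) ∈ polyFun n := by
  obtain ⟨p, hp, rfl⟩ := mem_polyFun.1 hf
  refine mem_polyFun.2 ⟨p.comp (Polynomial.C a * Polynomial.X + Polynomial.C b), ?_, ?_⟩
  · by_cases h0 : p = 0
    · simp [h0]
    rw [Polynomial.degree_eq_natDegree h0] at hp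
    refine (Polynomial.degree_le_natDegree.trans ?_).trans_lt hp
    rw [Nat.cast_le]
    refine Polynomial.natDegree_comp_le.trans ?_
    exact (Nat.mul_le_mul_left _ Polynomial.natDegree_linear_le).trans (mul_one _).le
  · ext x
    simp

theorem translationAction_mem_polyFun (P : LaurentPolynomial ℝ) {n : ℕ} {f : ℝ → ℝ}
    (hf : f ∈ polyFun n) : translationAction P f ∈ polyFun n := by
  induction P using LaurentPolynomial.induction_on' with
  | add P R hP hR =>
    rw [map_add]
    exact (polyFun n).add_mem hP hR
  | C_mul_T m a =>
    have h : translationAction (LaurentPolynomial.C a * LaurentPolynomial.T m) f =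
        a • fun x => f (1 * x + m) := by
      ext x
      rw [translationAction_C_mul, translationAction_T, Pi.smul_apply, smul_eq_mul, one_mul]
    rw [h]
    exact (polyFun n).smul_mem _ (comp_affine_mem_polyFun hf _ _)

theorem translationAction_toLaurent_apply_zero (p : Polynomial ℝ) (f : ℝ → ℝ) :
    translationAction (Polynomial.toLaurent p) f 0 = p.sum fun k a => a * f k := by
  conv_lhs => rw [p.as_sum_support_C_mul_X_pow]
  rw [map_sum, translationAction_sum_apply, Polynomial.sum_def]
  refine Finset.sum_congr rfl fun k _ => ?_
  rw [Polynomial.toLaurent_C_mul_X_pow, translationAction_C_mul, translationAction_T]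
  simp

/-- A polynomial whose translation action annihilates polynomials of degree `< n` at `0` is
divisible by `(X - 1)^n`. -/
theorem X_sub_one_pow_dvd_of_translationAction {n : ℕ} (p : Polynomial ℝ)
    (h : ∀ f ∈ polyFun n, translationAction (Polynomial.toLaurent p) f 0 = 0) :
    (Polynomial.X - Polynomial.C 1) ^ n ∣ p := by
  rw [Polynomial.X_sub_C_pow_dvd_iff, Polynomial.X_pow_dvd_iff]
  intro d hd
  have hmem : (fun x => (descPochhammer ℝ d).eval x) ∈ polyFun n :=
    mem_polyFun.2 ⟨descPochhammer ℝ d, by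
      refine Polynomial.degree_le_natDegree.trans_lt ?_
      rw [descPochhammer_natDegree]
      exact_mod_cast hd, rfl⟩
  have h0 := h _ hmem
  rw [translationAction_toLaurent_apply_zero, Polynomial.sum_def] at h0
  have hf : (d.factorial : ℝ) ≠ 0 := by positivity
  refine (mul_eq_zero.1 ?_).resolve_left hf
  rw [Polynomial.comp_eq_sum_left, Polynomial.sum_def, Polynomial.finsetSum_coeff,
    Finset.mul_sum, ← h0]
  refine Finset.sum_congr rfl fun k _ => ?_
  rw [Polynomial.coeff_C_mul, Polynomial.C_1, Polynomial.coeff_X_add_one_pow,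
    descPochhammer_eval_eq_descFactorial, Nat.descFactorial_eq_factorial_mul_choose]
  push_cast
  ring

theorem T_sub_one_pow_dvd_of_translationAction {n : ℕ} (P : LaurentPolynomial ℝ)
    (h : ∀ f ∈ polyFun n, translationAction P f = 0) :
    (LaurentPolynomial.T 1 - 1) ^ n ∣ P := by
  obtain ⟨m, p, hp⟩ := LaurentPolynomial.exists_T_pow P
  have hdvd : (Polynomial.X - Polynomial.C 1) ^ n ∣ p := by
    refine X_sub_one_pow_dvd_of_translationAction p fun f hf => ?_
    rw [hp, mul_comm, translationAction_mul_apply, h f hf, map_zero, Pi.zero_apply]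
  have h2 := map_dvd (Polynomial.toLaurent (R := ℝ)) hdvd
  rw [hp, map_pow, map_sub, Polynomial.toLaurent_X, Polynomial.toLaurent_C, map_one] at h2
  exact (LaurentPolynomial.isUnit_T (m : ℤ)).dvd_mul_right.1 h2

/-- Finite differences of order `n` with step `-1` annihilate polynomials of degree `< n`. -/
theorem alternating_sum_polyFun_eq_zero {n : ℕ} {f : ℝ → ℝ} (hf : f ∈ polyFun n) (y : ℝ) :
    ∑ j ∈ range (n + 1), (-1 : ℝ) ^ j * (n.choose j : ℝ) * f (y - j) = 0 := by
  obtain ⟨q, hq, hfq⟩ := mem_polyFun.1 (comp_affine_mem_polyFun hf (-1) y)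
  rcases Nat.eq_zero_or_pos n with rfl | hn
  · have hf0 : f = 0 := by
      obtain ⟨p, hp, rfl⟩ := mem_polyFun.1 hf
      ext x
      simp [Polynomial.degree_eq_bot.1 (Nat.WithBot.lt_zero_iff.1 hp)]
    simp [hf0]
  have hq' : q.natDegree < n := by
    by_cases h0 : q = 0
    · simpa [h0] using hn
    · exact (Polynomial.natDegree_lt_iff_degree_lt h0).2 hq
  have h := congrFun (Polynomial.fwdDiff_iter_eq_zero_of_degree_lt hq') 0
  rw [fwdDiff_iter_eq_sum_shift] at h
  have key : ∀ j ∈ range (n + 1), (-1 : ℝ) ^ j * (n.choose j : ℝ) * f (y - j) =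
      (-1) ^ n * (((-1 : ℤ) ^ (n - j) * (n.choose j : ℤ)) • q.eval (0 + j • (1 : ℝ))) := by
    intro j hj
    have hj' : j ≤ n := Nat.lt_succ_iff.1 (Finset.mem_range.1 hj)
    have e1 : q.eval (j : ℝ) = f (y - j) := by
      have := congrFun hfq j
      rw [← this]
      congr 1
      ring
    have e2 : (-1 : ℝ) ^ n * (-1) ^ (n - j) = (-1) ^ j := by
      obtain ⟨i, rfl⟩ := Nat.exists_eq_add_of_le hj'
      rw [Nat.add_sub_cancel_left, pow_add, mul_assoc, ← mul_pow]
      simp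
    simp only [zero_add, nsmul_eq_mul, mul_one, zsmul_eq_mul, e1, ← e2]
    push_cast
    ring
  rw [Finset.sum_congr rfl key, ← Finset.mul_sum, h]
  simp

/-! ### Spline series with polynomial coefficients -/

/-- The cardinal spline series `x ↦ Σ_s g(s) M_n(x - s)`. -/
def splineSeries (n : ℕ) (g : ℝ → ℝ) (x : ℝ) : ℝ := ∑' s : ℤ, g s * bspline n (x - s)

theorem finite_support_bspline_sub (n : ℕ) (x : ℝ) :
    (Function.support fun s : ℤ => bspline n (x - s)).Finite := by
  refine (Set.finite_Icc ⌈x - n⌉ ⌊x⌋).subset fun s hs => ?_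
  have h : x - s ∈ Set.Icc (0 : ℝ) n := by
    by_contra h
    exact hs (bspline_eq_zero_of_notMem n h)
  exact ⟨Int.ceil_le.2 (by linarith [h.2]), Int.le_floor.2 (by linarith [h.1])⟩

theorem summable_mul_bspline_sub (n : ℕ) (g : ℤ → ℝ) (x : ℝ) :
    Summable fun s : ℤ => g s * bspline n (x - s) :=
  summable_of_hasFiniteSupport <| (finite_support_bspline_sub n x).subset
    (Function.support_mul_subset_right _ _)

/-- The sum over even indices `j ≡ m (mod 2)` of the refinement mask against a polynomial
of low degree is half of the full sum. -/
theorem two_mul_sum_parity {n : ℕ} {f : ℝ → ℝ} (hf : f ∈ polyFun n) (m : ℤ) :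
    2 * ∑ j ∈ range (n + 1), (if Even (m - j) then (n.choose j : ℝ) * f (m - j) else 0) =
      ∑ j ∈ range (n + 1), (n.choose j : ℝ) * f (m - j) := by
  have h : 2 * ∑ j ∈ range (n + 1), (if Even (m - j) then (n.choose j : ℝ) * f (m - j) else 0) =
      ∑ j ∈ range (n + 1), (n.choose j : ℝ) * f (m - j) + ((m.negOnePow : ℤ) : ℝ) *
        ∑ j ∈ range (n + 1), (-1 : ℝ) ^ j * (n.choose j : ℝ) * f (m - j) := by
    rw [Finset.mul_sum, Finset.mul_sum, ← Finset.sum_add_distrib]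
    refine Finset.sum_congr rfl fun j _ => ?_
    rcases Int.even_or_odd m with hm | hm <;> rcases Nat.even_or_odd j with hj | hj
    · rw [if_pos (hm.sub ((Int.even_coe_nat j).2 hj)), Int.negOnePow_even m hm, hj.neg_one_pow]
      simp [two_mul]
    · rw [if_neg (Int.not_even_iff_odd.2 (hm.sub_odd ((Int.odd_coe_nat j).2 hj))),
        Int.negOnePow_even m hm, hj.neg_one_pow]
      simp
    · rw [if_neg (Int.not_even_iff_odd.2 (hm.sub_even ((Int.even_coe_nat j).2 hj))),
        Int.negOnePow_odd m hm, hj.neg_one_pow]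
      simp
    · rw [if_pos (hm.sub_odd ((Int.odd_coe_nat j).2 hj)), Int.negOnePow_odd m hm, hj.neg_one_pow]
      simp [two_mul]
  rw [h, alternating_sum_polyFun_eq_zero hf, mul_zero, add_zero]

/-- The refinement mask `2^{-n} (1 + z⁻¹)^n`. -/
def refinementMask (n : ℕ) : LaurentPolynomial ℝ :=
  LaurentPolynomial.C ((2 : ℝ) ^ n)⁻¹ * (1 + LaurentPolynomial.T (-1)) ^ n

theorem translationAction_refinementMask (n : ℕ) (f : ℝ → ℝ) (x : ℝ) :
    translationAction (refinementMask n) f x =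
      ((2 : ℝ) ^ n)⁻¹ * ∑ j ∈ range (n + 1), (n.choose j : ℝ) * f (x - j) := by
  rw [refinementMask, translationAction_C_mul, add_comm, add_pow, translationAction_sum_apply]
  congr 1
  refine Finset.sum_congr rfl fun j _ => ?_
  rw [one_pow, mul_one, mul_comm, ← map_natCast LaurentPolynomial.C, translationAction_C_mul,
    LaurentPolynomial.T_pow, translationAction_T]
  simp [sub_eq_add_neg]

theorem splineSeries_refinement {n : ℕ} {f : ℝ → ℝ} (hf : f ∈ polyFun (n + 1)) (x : ℝ) :
    splineSeries (n + 1) (fun y => f (2 * y)) x =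
      splineSeries (n + 1) (translationAction (refinementMask (n + 1)) f) (2 * x) := by
  have hmask (m : ℤ) : translationAction (refinementMask (n + 1)) f m = ((2 : ℝ) ^ n)⁻¹ *
      ∑ j ∈ range (n + 2), (if Even (m - j) then ((n + 1).choose j : ℝ) * f (m - j) else 0) := by
    rw [translationAction_refinementMask, ← two_mul_sum_parity hf, pow_succ]
    field_simp
  have hterm (s : ℤ) : f (2 * s) * bspline (n + 1) (x - s) = ((2 : ℝ) ^ n)⁻¹ *
      ∑ j ∈ range (n + 2), ((n + 1).choose j : ℝ) *
        (f (2 * s) * bspline (n + 1) (2 * x - (2 * s + j : ℤ))) := by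
    rw [bspline_refinement, mul_left_comm, Finset.mul_sum]
    congr 1
    refine Finset.sum_congr rfl fun j _ => ?_
    rw [mul_left_comm]
    congr 3
    push_cast
    ring
  have hinj (j : ℕ) : Function.Injective fun s : ℤ => 2 * s + (j : ℤ) := fun a b h => by
    simpa using h
  have hsum (j : ℕ) : ∑' s : ℤ, f (2 * s) * bspline (n + 1) (2 * x - (2 * s + j : ℤ)) =
      ∑' m : ℤ, (if Even (m - j) then f (m - j) else 0) * bspline (n + 1) (2 * x - m) := by
    rw [← (hinj j).tsum_eq (f := fun m : ℤ =>
      (if Even (m - j) then f (m - j) else 0) * bspline (n + 1) (2 * x - m))]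
    · simp
    · intro m hm
      have he : Even (m - j) := by
        by_contra h
        simp [h] at hm
      obtain ⟨s, hs⟩ := he
      exact ⟨s, by simp only; omega⟩
  have hS (j : ℕ) : Summable fun s : ℤ =>
      f (2 * s) * bspline (n + 1) (2 * x - (2 * s + j : ℤ)) := by
    refine summable_of_hasFiniteSupport <| ((finite_support_bspline_sub (n + 1) (2 * x)).preimage
      (hinj j).injOn).subset (Function.support_mul_subset_right _ _)
  simp only [splineSeries, hmask, hterm]
  rw [tsum_mul_left, Summable.tsum_finsetSum fun j _ => (hS j).mul_left _]
  simp only [tsum_mul_left, hsum]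
  simp only [mul_assoc, Finset.sum_mul]
  rw [tsum_mul_left, Summable.tsum_finsetSum fun j _ => summable_mul_bspline_sub _ _ _]
  congr 1
  refine Finset.sum_congr rfl fun j _ => ?_
  rw [← tsum_mul_left]
  refine tsum_congr fun m => ?_
  split_ifs <;> ring

/-! ### The symbol of a quasi-interpolation operator -/

theorem sum_neg_Icc {M : Type*} [AddCommMonoid M] (μ : ℕ) (F : ℤ → M) :
    ∑ j ∈ Finset.Icc (-(μ : ℤ)) μ, F (-j) = ∑ j ∈ Finset.Icc (-(μ : ℤ)) μ, F j := by
  refine Finset.sum_nbij' (fun j => -j) (fun j => -j) ?_ ?_ ?_ ?_ ?_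
  all_goals intro j hj
  all_goals simp at hj ⊢
  all_goals omega

theorem translationAction_PLam (k μ : ℕ) (lam : ℤ → ℝ) (f : ℝ → ℝ) (x : ℝ) :
    translationAction (PLam (2 * k) μ lam) f x =
      ∑ j ∈ Finset.Icc (-(μ : ℤ)) μ, lam j * f (x + (j + k)) := by
  rw [PLam, translationAction_sum_apply]
  refine Finset.sum_congr rfl fun j _ => ?_
  rw [translationAction_C_mul, translationAction_T]
  simp

theorem translationAction_PLamSq (k μ : ℕ) (lam : ℤ → ℝ) (f : ℝ → ℝ) (x : ℝ) :
    translationAction (PLamSq (2 * k) μ lam) f x =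
      ∑ j ∈ Finset.Icc (-(μ : ℤ)) μ, lam j * f (x + 2 * (j + k)) := by
  rw [PLamSq, translationAction_sum_apply]
  refine Finset.sum_congr rfl fun j _ => ?_
  rw [translationAction_C_mul, translationAction_T]
  simp

theorem splineSeries_translationAction_PLam {k μ : ℕ} {lam : ℤ → ℝ} (hlam : IsEvenSeq lam)
    (hQI : IsQuasiInterp (2 * k) μ lam) {f : ℝ → ℝ} (hf : f ∈ polyFun (2 * k)) :
    splineSeries (2 * k) (translationAction (PLam (2 * k) μ lam) f) = f := by
  obtain ⟨p, hp, rfl⟩ := mem_polyFun.1 hf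
  ext x
  rw [← hQI p hp x, splineSeries, Qbase]
  refine tsum_congr fun s => ?_
  rw [translationAction_PLam, ← sum_neg_Icc]
  congr 1
  refine Finset.sum_congr rfl fun j _ => ?_
  rw [hlam j]
  congr 2
  push_cast
  ring

theorem exists_translationAction_PLam_eq {k μ : ℕ} {lam : ℤ → ℝ} (hlam : IsEvenSeq lam)
    (hQI : IsQuasiInterp (2 * k) μ lam) {g : ℝ → ℝ} (hg : g ∈ polyFun (2 * k)) :
    ∃ f ∈ polyFun (2 * k), translationAction (PLam (2 * k) μ lam) f = g := by
  let U : polyFun (2 * k) →ₗ[ℝ] polyFun (2 * k) :=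
    (translationAction (PLam (2 * k) μ lam)).restrict fun _ hf => translationAction_mem_polyFun _ hf
  have hU : Function.Injective U := fun a b hab => by
    have h : translationAction (PLam (2 * k) μ lam) a = translationAction (PLam (2 * k) μ lam) b :=
      congrArg Subtype.val hab
    ext1
    rw [← splineSeries_translationAction_PLam hlam hQI a.2, h,
      splineSeries_translationAction_PLam hlam hQI b.2]
  obtain ⟨f, hf⟩ := LinearMap.injective_iff_surjective.1 hU ⟨g, hg⟩
  exact ⟨f, f.2, congrArg Subtype.val hf⟩

/-- On polynomials of degree `< ℓ`, the symbol satisfies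
`P_Λ(z) = 2^{-ℓ} (1 + z⁻¹)^ℓ P_Λ(z²)`. -/
theorem translationAction_PLam_eq {k μ : ℕ} (hk : 0 < k) {lam : ℤ → ℝ} (hlam : IsEvenSeq lam)
    (hQI : IsQuasiInterp (2 * k) μ lam) {f : ℝ → ℝ} (hf : f ∈ polyFun (2 * k)) :
    translationAction (PLam (2 * k) μ lam) f =
      translationAction (PLamSq (2 * k) μ lam * refinementMask (2 * k)) f := by
  have hg : (fun x => f (2 * x)) ∈ polyFun (2 * k) := by
    simpa using comp_affine_mem_polyFun hf 2 0
  obtain ⟨h, hh, hPh⟩ := exists_translationAction_PLam_eq hlam hQI hg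
  obtain ⟨h', hh', hPh'⟩ := exists_translationAction_PLam_eq hlam hQI
    (translationAction_mem_polyFun (refinementMask (2 * k)) hf)
  have hdil (x : ℝ) : h' (2 * x) = h x := by
    rw [← splineSeries_translationAction_PLam hlam hQI hh,
      ← splineSeries_translationAction_PLam hlam hQI hh', hPh, hPh']
    obtain ⟨n, hn⟩ := Nat.exists_eq_succ_of_ne_zero (by omega : 2 * k ≠ 0)
    rw [hn] at hf ⊢
    exact (splineSeries_refinement hf x).symm
  have hsq : translationAction (PLamSq (2 * k) μ lam) h' = f := by
    ext x
    have hx := congrFun hPh (x / 2)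
    rw [translationAction_PLam] at hx
    rw [translationAction_PLamSq]
    have e : f (2 * (x / 2)) = f x := by congr 1; ring
    rw [← e, ← hx]
    refine Finset.sum_congr rfl fun j _ => ?_
    rw [← hdil]
    congr 2
    ring
  rw [translationAction_mul_apply, ← hPh', translationAction_comm, hsq]

theorem T_sub_one_pow_dvd_PLam_sub {k μ : ℕ} (hk : 0 < k) {lam : ℤ → ℝ} (hlam : IsEvenSeq lam)
    (hQI : IsQuasiInterp (2 * k) μ lam) :
    (LaurentPolynomial.T 1 - 1) ^ (2 * k) ∣
      PLam (2 * k) μ lam - PLamSq (2 * k) μ lam * refinementMask (2 * k) := by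
  refine T_sub_one_pow_dvd_of_translationAction _ fun f hf => ?_
  rw [map_sub, LinearMap.sub_apply, translationAction_PLam_eq hk hlam hQI hf, sub_self]

/-! ### Closed forms and symmetry -/

theorem sum_range_two_mul_add_one {M : Type*} [AddCommMonoid M] (k : ℕ) (F : ℕ → M) :
    ∑ j ∈ range (2 * k + 1), F j =
      ∑ j ∈ range (k + 1), F (2 * j) + ∑ j ∈ range k, F (2 * j + 1) := by
  induction k with
  | zero => simp
  | succ k ih =>
    rw [show 2 * (k + 1) + 1 = 2 * k + 1 + 1 + 1 by ring, Finset.sum_range_succ _ (2 * k + 1 + 1),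
      Finset.sum_range_succ _ (2 * k + 1), ih, Finset.sum_range_succ _ (k + 1),
      Finset.sum_range_succ (fun j => F (2 * j + 1)) k]
    simp only [show 2 * k + 1 + 1 = 2 * (k + 1) by ring]
    abel

theorem one_add_pow_two_mul {R : Type*} [CommRing R] (k : ℕ) (u : R) :
    (1 + u) ^ (2 * k) = ∑ j ∈ range (k + 1), ((2 * k).choose (2 * j) : R) * u ^ (2 * j) +
      ∑ j ∈ range k, ((2 * k).choose (2 * j + 1) : R) * u ^ (2 * j + 1) := by
  rw [add_comm 1 u, add_pow, sum_range_two_mul_add_one]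
  simp only [one_pow, mul_one]
  simp only [mul_comm (u ^ _)]

theorem one_sub_pow_two_mul {R : Type*} [CommRing R] (k : ℕ) (u : R) :
    (1 - u) ^ (2 * k) = ∑ j ∈ range (k + 1), ((2 * k).choose (2 * j) : R) * u ^ (2 * j) -
      ∑ j ∈ range k, ((2 * k).choose (2 * j + 1) : R) * u ^ (2 * j + 1) := by
  rw [sub_eq_add_neg 1 u, one_add_pow_two_mul]
  simp only [(even_two_mul _).neg_pow, (odd_two_mul_add_one _).neg_pow, mul_neg,
    Finset.sum_neg_distrib, sub_eq_add_neg]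

theorem add_pow_add_sub_pow {R : Type*} [CommRing R] (k : ℕ) (u : R) :
    (1 + u) ^ (2 * k) + (1 - u) ^ (2 * k) =
      2 * ∑ j ∈ range (k + 1), ((2 * k).choose (2 * j) : R) * u ^ (2 * j) := by
  rw [one_add_pow_two_mul, one_sub_pow_two_mul]
  ring

theorem add_pow_sub_sub_pow {R : Type*} [CommRing R] (k : ℕ) (u : R) :
    (1 + u) ^ (2 * k) - (1 - u) ^ (2 * k) =
      2 * ∑ j ∈ range k, ((2 * k).choose (2 * j + 1) : R) * u ^ (2 * j + 1) := by
  rw [one_add_pow_two_mul, one_sub_pow_two_mul]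
  ring

theorem two_zpow_one_sub (n : ℕ) : (2 : ℝ) ^ (1 - (n : ℤ)) = ((2 : ℝ) ^ n)⁻¹ * 2 := by
  rw [zpow_sub₀ two_ne_zero, zpow_one, zpow_natCast]
  ring

theorem PevenAux_eq (k μ : ℕ) (lam : ℤ → ℝ) :
    PevenAux (2 * k) μ lam = LaurentPolynomial.C ((2 : ℝ) ^ (2 * k))⁻¹ * PLamSq (2 * k) μ lam *
      ((1 + LaurentPolynomial.T (-1)) ^ (2 * k) + (1 - LaurentPolynomial.T (-1)) ^ (2 * k)) := by
  rw [PevenAux, two_zpow_one_sub, add_pow_add_sub_pow, Nat.mul_div_cancel_left k two_pos, map_mul,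
    map_ofNat]
  simp only [LaurentPolynomial.T_pow, map_natCast]
  push_cast
  simp only [mul_neg, mul_one]
  ring

theorem PoddAux_eq (k μ : ℕ) (lam : ℤ → ℝ) :
    PoddAux (2 * k) μ lam = LaurentPolynomial.C ((2 : ℝ) ^ (2 * k))⁻¹ * PLamSq (2 * k) μ lam *
      ((1 + LaurentPolynomial.T (-1)) ^ (2 * k) - (1 - LaurentPolynomial.T (-1)) ^ (2 * k)) := by
  rw [PoddAux, two_zpow_one_sub, add_pow_sub_sub_pow, Nat.mul_div_cancel_left k two_pos, map_mul,
    map_ofNat]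
  simp only [LaurentPolynomial.T_pow, map_natCast]
  push_cast
  simp only [mul_neg, mul_one, neg_add, ← sub_eq_add_neg]
  ring

theorem one_sub_T_neg_pow (k : ℕ) :
    (1 - LaurentPolynomial.T (-1) : LaurentPolynomial ℝ) ^ (2 * k) =
      LaurentPolynomial.T (-(2 * k : ℕ)) * (LaurentPolynomial.T 1 - 1) ^ (2 * k) := by
  have h : (1 - LaurentPolynomial.T (-1) : LaurentPolynomial ℝ) =
      LaurentPolynomial.T (-1) * (LaurentPolynomial.T 1 - 1) := by
    rw [mul_sub, ← LaurentPolynomial.T_add]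
    simp
  rw [h, mul_pow, LaurentPolynomial.T_pow]
  simp

theorem T_mul_invert_PLam (k μ : ℕ) {lam : ℤ → ℝ} (hlam : IsEvenSeq lam) :
    LaurentPolynomial.T (2 * k) * LaurentPolynomial.invert (PLam (2 * k) μ lam) =
      PLam (2 * k) μ lam := by
  conv_rhs => rw [PLam, ← sum_neg_Icc]
  rw [PLam, map_sum, Finset.mul_sum]
  refine Finset.sum_congr rfl fun j _ => ?_
  rw [hlam j, map_mul, LaurentPolynomial.invert_C, LaurentPolynomial.invert_T, mul_left_comm,
    ← LaurentPolynomial.T_add]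
  congr 2
  push_cast
  omega

theorem T_mul_invert_PLamSq (k μ : ℕ) {lam : ℤ → ℝ} (hlam : IsEvenSeq lam) :
    LaurentPolynomial.T (4 * k) * LaurentPolynomial.invert (PLamSq (2 * k) μ lam) =
      PLamSq (2 * k) μ lam := by
  conv_rhs => rw [PLamSq, ← sum_neg_Icc]
  rw [PLamSq, map_sum, Finset.mul_sum]
  refine Finset.sum_congr rfl fun j _ => ?_
  rw [hlam j, map_mul, LaurentPolynomial.invert_C, LaurentPolynomial.invert_T, mul_left_comm,
    ← LaurentPolynomial.T_add]
  congr 2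
  push_cast
  omega

theorem T_mul_one_add_T_neg_pow (k : ℕ) :
    (LaurentPolynomial.T (2 * k) : LaurentPolynomial ℝ) * (1 + LaurentPolynomial.T (-1)) ^ (2 * k) =
      (1 + LaurentPolynomial.T 1) ^ (2 * k) := by
  have h : (1 + LaurentPolynomial.T 1 : LaurentPolynomial ℝ) =
      LaurentPolynomial.T 1 * (1 + LaurentPolynomial.T (-1)) := by
    rw [mul_add, ← LaurentPolynomial.T_add, add_comm]
    simp
  rw [h, mul_pow, LaurentPolynomial.T_pow]
  simp

theorem T_mul_one_sub_T_neg_pow (k : ℕ) :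
    (LaurentPolynomial.T (2 * k) : LaurentPolynomial ℝ) * (1 - LaurentPolynomial.T (-1)) ^ (2 * k) =
      (1 - LaurentPolynomial.T 1) ^ (2 * k) := by
  rw [one_sub_T_neg_pow, ← mul_assoc, ← LaurentPolynomial.T_add,
    ← Even.neg_pow (even_two_mul k) (1 - LaurentPolynomial.T 1)]
  simp

/-- If `(z-1)^ℓ P` is invariant under `F ↦ z^ℓ F(1/z)` for even `ℓ`, then `P` is symmetric. -/
theorem isSymmLaurent_of_T_mul_invert {k : ℕ} {P : LaurentPolynomial ℝ}
    (h : LaurentPolynomial.T (2 * k) *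
      LaurentPolynomial.invert ((LaurentPolynomial.T 1 - 1) ^ (2 * k) * P) =
        (LaurentPolynomial.T 1 - 1) ^ (2 * k) * P) : IsSymmLaurent P := by
  have hne : ((LaurentPolynomial.T 1 - 1 : LaurentPolynomial ℝ)) ^ (2 * k) ≠ 0 := by
    refine pow_ne_zero _ fun h0 => ?_
    have h1 : (LaurentPolynomial.T 1 : LaurentPolynomial ℝ).coeff 1 =
        (LaurentPolynomial.T 0 : LaurentPolynomial ℝ).coeff 1 := by
      rw [sub_eq_zero.1 h0, LaurentPolynomial.T_zero]
    rw [LaurentPolynomial.T_apply, LaurentPolynomial.T_apply] at h1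
    norm_num at h1
  have hinv : LaurentPolynomial.invert P = P := by
    refine mul_left_cancel₀ hne ?_
    rw [← h, map_mul, map_pow, map_sub, map_one, LaurentPolynomial.invert_T, ← mul_assoc,
      ← Even.neg_pow (even_two_mul k) (LaurentPolynomial.T (-1) - 1), neg_sub,
      T_mul_one_sub_T_neg_pow, ← Even.neg_pow (even_two_mul k) (1 - LaurentPolynomial.T 1), neg_sub]
  refine ⟨0, fun s => ?_⟩
  rw [zero_sub, lcoeff, lcoeff, ← LaurentPolynomial.invert_apply, hinv]

theorem T_mul_invert_Peven (k μ : ℕ) {lam : ℤ → ℝ} (hlam : IsEvenSeq lam) :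
    LaurentPolynomial.T (2 * k) * LaurentPolynomial.invert (Peven (2 * k) μ lam) =
      Peven (2 * k) μ lam := by
  rw [Peven, PevenAux_eq, map_sub, mul_sub, T_mul_invert_PLam k μ hlam]
  simp only [map_mul, map_add, map_sub, map_pow, map_one, LaurentPolynomial.invert_C,
    LaurentPolynomial.invert_T, neg_neg]
  rw [← T_mul_one_add_T_neg_pow, ← T_mul_one_sub_T_neg_pow]
  conv_rhs => rw [← T_mul_invert_PLamSq k μ hlam,
    show (4 * k : ℤ) = 2 * k + 2 * k by ring, LaurentPolynomial.T_add]
  ring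

theorem T_mul_invert_Podd (k μ : ℕ) {lam : ℤ → ℝ} (hlam : IsEvenSeq lam) :
    LaurentPolynomial.T (2 * k) * LaurentPolynomial.invert (Podd (2 * k) μ lam) =
      Podd (2 * k) μ lam := by
  rw [Podd, PoddAux_eq, map_sub, mul_sub, T_mul_invert_PLam k μ hlam]
  simp only [map_mul, map_sub, map_add, map_pow, map_one, LaurentPolynomial.invert_C,
    LaurentPolynomial.invert_T, neg_neg]
  rw [← T_mul_one_add_T_neg_pow, ← T_mul_one_sub_T_neg_pow]
  conv_rhs => rw [← T_mul_invert_PLamSq k μ hlam,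
    show (4 * k : ℤ) = 2 * k + 2 * k by ring, LaurentPolynomial.T_add]
  ring

/-- if `Q` is a quasi-interpolation operator (reproducing polynomials of
degree at most `ℓ-1`), then `(z-1)^ℓ` divides both `P_even` and `P_odd` in `ℝ[z,z⁻¹]`,
with symmetric Laurent polynomial quotients. -/
theorem Peven_Podd_factorization (ℓ μ : ℕ) (hℓe : Even ℓ) (hℓ : 0 < ℓ) (hμ : ℓ/2 - 1 ≤ μ)
    (lam : ℤ → ℝ) (hlam : IsEvenSeq lam) (hQI : IsQuasiInterp ℓ μ lam) :
    ∃ Pe Po : LaurentPolynomial ℝ, IsSymmLaurent Pe ∧ IsSymmLaurent Po ∧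
      Peven ℓ μ lam = (LaurentPolynomial.T 1 - 1) ^ ℓ * Pe ∧
      Podd ℓ μ lam = (LaurentPolynomial.T 1 - 1) ^ ℓ * Po := by
  obtain ⟨k, rfl⟩ := even_iff_exists_two_mul.1 hℓe
  obtain ⟨D, hD⟩ := T_sub_one_pow_dvd_PLam_sub (by omega) hlam hQI
  rw [refinementMask] at hD
  set R := LaurentPolynomial.C ((2 : ℝ) ^ (2 * k))⁻¹ * PLamSq (2 * k) μ lam *
    LaurentPolynomial.T (-(2 * k : ℕ))
  have he : Peven (2 * k) μ lam = (LaurentPolynomial.T 1 - 1) ^ (2 * k) * (D - R) := by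
    rw [mul_sub, ← hD, Peven, PevenAux_eq, one_sub_T_neg_pow]
    ring
  have ho : Podd (2 * k) μ lam = (LaurentPolynomial.T 1 - 1) ^ (2 * k) * (D + R) := by
    rw [mul_add, ← hD, Podd, PoddAux_eq, one_sub_T_neg_pow]
    ring
  refine ⟨D - R, D + R, isSymmLaurent_of_T_mul_invert (k := k) ?_,
    isSymmLaurent_of_T_mul_invert (k := k) ?_, he, ho⟩
  · rw [← he, T_mul_invert_Peven k μ hlam]
  · rw [← ho, T_mul_invert_Podd k μ hlam]
end
end
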